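/- arXiv:1407.3522 — 9 statements merged into one kernel-verified Lean document; each statement's English description precedes it below -/
import Mathlib

section
/- Let H be a real Hilbert space, Q a bounded self-adjoint nonnegative operator on H, n a positive integer, and R a two-sided inverse of Q + n⁻¹·I. Let x ∈ H and set v := Qx. If v ≠ 0, then x ≠ 0, Rv ≠ 0, and 4(‖v‖² − n⁻¹⟨Rv, v⟩)² / (‖v‖² · ‖Rv‖²) ≥ 2‖v‖²/‖x‖² − 4/n². -/
open scoped RealInnerProductSpace

/-- For a bounded self-adjoint nonnegative operator `Q` on a real Hilbert space,
`n` a positive integer, and `R` a two-sided inverse of `Q + n⁻¹ • I`, if `x ∈ H` and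
`v := Qx ≠ 0`, then `x ≠ 0`, `Rv ≠ 0`, and
`4(‖v‖² − n⁻¹⟨Rv, v⟩)² / (‖v‖² ‖Rv‖²) ≥ 2‖v‖²/‖x‖² − 4/n²`. -/
theorem stmt1 {H : Type*} [NormedAddCommGroup H] [InnerProductSpace ℝ H] [CompleteSpace H]
    (Q R : H →L[ℝ] H)
    (hQsa : ∀ x y : H, ⟪Q x, y⟫ = ⟪x, Q y⟫)
    (hQpos : ∀ x : H, 0 ≤ ⟪Q x, x⟫)
    (n : ℕ) (hn : 0 < n)
    (hRl : R.comp (Q + (n : ℝ)⁻¹ • ContinuousLinearMap.id ℝ H) = ContinuousLinearMap.id ℝ H)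
    (hRr : (Q + (n : ℝ)⁻¹ • ContinuousLinearMap.id ℝ H).comp R = ContinuousLinearMap.id ℝ H)
    (x : H) (hv : Q x ≠ 0) :
    x ≠ 0 ∧ R (Q x) ≠ 0 ∧
    2 * ‖Q x‖ ^ 2 / ‖x‖ ^ 2 - 4 / (n : ℝ) ^ 2
      ≤ 4 * (‖Q x‖ ^ 2 - (n : ℝ)⁻¹ * ⟪R (Q x), Q x⟫) ^ 2 / (‖Q x‖ ^ 2 * ‖R (Q x)‖ ^ 2) := by
  have he : 0 < (n : ℝ)⁻¹ := by positivity
  have hsq : 4 / (n : ℝ) ^ 2 = 4 * (n : ℝ)⁻¹ ^ 2 := by rw [inv_pow]; rfl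
  rw [hsq]
  generalize (n : ℝ)⁻¹ = e at *
  have hl : ∀ z, R (Q z + e • z) = z := fun z => by
    simpa using congrArg (fun f : H →L[ℝ] H => f z) hRl
  have hr : ∀ z, Q (R z) + e • R z = z := fun z => by
    simpa using congrArg (fun f : H →L[ℝ] H => f z) hRr
  have hx : x ≠ 0 := fun h => hv (by rw [h, map_zero])
  have hw : R (Q x) ≠ 0 := fun h => hv (by simpa [h] using (hr (Q x)).symm)
  refine ⟨hx, hw, ?_⟩
  have hcomm : R (Q x) = Q (R x) := by
    conv_lhs => rw [← hr x]
    rw [map_add, map_smul, hl]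
  -- the contraction estimate `‖R Q x‖ ≤ ‖x‖`
  have hle : ‖R (Q x)‖ ^ 2 ≤ ‖x‖ ^ 2 := by
    have h : ‖x‖ ^ 2 = ‖R (Q x)‖ ^ 2 + 2 * (e * ⟪Q (R x), R x⟫) + ‖e • R x‖ ^ 2 := by
      rw [hcomm, ← real_inner_smul_right, ← norm_add_sq_real, hr]
    nlinarith [mul_nonneg he.le (hQpos (R x)), sq_nonneg ‖e • R x‖]
  have hcs : ⟪R (Q x), Q x⟫ ^ 2 ≤ ‖R (Q x)‖ ^ 2 * ‖Q x‖ ^ 2 := by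
    rw [← mul_pow]
    exact sq_le_sq' (neg_le_of_abs_le (abs_real_inner_le_norm _ _)) (real_inner_le_norm _ _)
  have hvpos : 0 < ‖Q x‖ ^ 2 := by positivity
  have hwpos : 0 < ‖R (Q x)‖ ^ 2 := by positivity
  generalize ⟪R (Q x), Q x⟫ = s at *
  generalize ‖R (Q x)‖ ^ 2 = c at *
  generalize ‖Q x‖ ^ 2 = V at *
  have hdiv : 2 * V / ‖x‖ ^ 2 ≤ 2 * V / c := by gcongr
  have hmain : 2 * V / c - 4 * e ^ 2 ≤ 4 * (V - e * s) ^ 2 / (V * c) := by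
    have heq : 2 * V / c - 4 * e ^ 2 = (2 * V ^ 2 - 4 * e ^ 2 * (c * V)) / (V * c) := by
      field_simp
    rw [heq]
    gcongr
    nlinarith [mul_le_mul_of_nonneg_left hcs (sq_nonneg e), sq_nonneg (V - 2 * (e * s))]
  linarith
end

section
/- Let H be a real Hilbert space, Q a bounded self-adjoint nonnegative operator on H, n a positive integer, and R a two-sided inverse of Q + n⁻¹·I. Let h : [0,∞) → ℝ satisfy h(0) = 0 and |h(a) − h(b)| ≤ L|a − b| for all a, b ≥ 0, where L > 0. Then for every v ∈ H with v ≠ 0: (2 h(n‖v‖)² / (‖v‖ · ‖Rv‖²)) · (‖QRv‖² − ⟨QRv, v⟩²/‖v‖²) ≤ 2L²‖v‖. -/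
open scoped RealInnerProductSpace

/-- Subtracting a multiple of `v` does not change the component orthogonal to `v`, so the squared
norm of the component of `v - c • w` orthogonal to `v` is at most `c ^ 2 * ‖w‖ ^ 2`. -/
lemma norm_sq_sub_inner_sq_div_le {H : Type*} [NormedAddCommGroup H] [InnerProductSpace ℝ H]
    {v : H} (hv : v ≠ 0) (w : H) (c : ℝ) :
    ‖v - c • w‖ ^ 2 - ⟪v - c • w, v⟫ ^ 2 / ‖v‖ ^ 2 ≤ c ^ 2 * ‖w‖ ^ 2 := by
  have hv' : ‖v‖ ≠ 0 := norm_ne_zero_iff.mpr hv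
  have key : ‖v - c • w‖ ^ 2 - ⟪v - c • w, v⟫ ^ 2 / ‖v‖ ^ 2
      = c ^ 2 * ‖w‖ ^ 2 - (c * ⟪v, w⟫ / ‖v‖) ^ 2 := by
    rw [norm_sub_sq_real, inner_sub_left, real_inner_self_eq_norm_sq, real_inner_smul_left,
      real_inner_smul_right, norm_smul, mul_pow, Real.norm_eq_abs, sq_abs, real_inner_comm v w]
    field_simp
    ring
  rw [key]
  exact sub_le_self _ (sq_nonneg _)

/-- For a bounded self-adjoint nonnegative operator `Q` on a real Hilbert space,
`n` a positive integer, `R` a two-sided inverse of `Q + n⁻¹ • I`, and `h : [0,∞) → ℝ` with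
`h(0) = 0` and Lipschitz constant `L > 0`, for every `v ≠ 0`:
`(2 h(n‖v‖)² / (‖v‖‖Rv‖²)) (‖QRv‖² − ⟨QRv, v⟩²/‖v‖²) ≤ 2L²‖v‖`. -/
theorem stmt2 {H : Type*} [NormedAddCommGroup H] [InnerProductSpace ℝ H] [CompleteSpace H]
    (Q R : H →L[ℝ] H)
    (hQsa : ∀ x y : H, ⟪Q x, y⟫ = ⟪x, Q y⟫)
    (hQpos : ∀ x : H, 0 ≤ ⟪Q x, x⟫)
    (n : ℕ) (hn : 0 < n)
    (hRl : R.comp (Q + (n : ℝ)⁻¹ • ContinuousLinearMap.id ℝ H) = ContinuousLinearMap.id ℝ H)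
    (hRr : (Q + (n : ℝ)⁻¹ • ContinuousLinearMap.id ℝ H).comp R = ContinuousLinearMap.id ℝ H)
    (h : ℝ → ℝ) (L : ℝ) (hL : 0 < L) (hh0 : h 0 = 0)
    (hLip : ∀ a b : ℝ, 0 ≤ a → 0 ≤ b → |h a - h b| ≤ L * |a - b|)
    (v : H) (hv : v ≠ 0) :
    2 * h ((n : ℝ) * ‖v‖) ^ 2 / (‖v‖ * ‖R v‖ ^ 2)
        * (‖Q (R v)‖ ^ 2 - ⟪Q (R v), v⟫ ^ 2 / ‖v‖ ^ 2)
      ≤ 2 * L ^ 2 * ‖v‖ := by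
  have hn' : (0 : ℝ) < n := by exact_mod_cast hn
  have hvpos : 0 < ‖v‖ := norm_pos_iff.mpr hv
  have hQR : Q (R v) + (n : ℝ)⁻¹ • R v = v := by
    simpa using DFunLike.congr_fun hRr v
  have hRv : R v ≠ 0 := fun h0 => hv (by simpa [h0] using hQR.symm)
  have hRpos : 0 < ‖R v‖ := norm_pos_iff.mpr hRv
  have hbound : h (n * ‖v‖) ^ 2 ≤ (L * (n * ‖v‖)) ^ 2 := by
    have hle := hLip (n * ‖v‖) 0 (by positivity) le_rfl
    rw [hh0, sub_zero, sub_zero, abs_of_nonneg (by positivity : 0 ≤ (n : ℝ) * ‖v‖)] at hle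
    exact sq_le_sq' (neg_le_of_abs_le hle) (le_of_abs_le hle)
  rw [eq_sub_of_add_eq hQR]
  calc
    _ ≤ 2 * h (n * ‖v‖) ^ 2 / (‖v‖ * ‖R v‖ ^ 2) * ((n : ℝ)⁻¹ ^ 2 * ‖R v‖ ^ 2) := by
      gcongr
      exact norm_sq_sub_inner_sq_div_le hv _ _
    _ ≤ 2 * (L * (n * ‖v‖)) ^ 2 / (‖v‖ * ‖R v‖ ^ 2) * ((n : ℝ)⁻¹ ^ 2 * ‖R v‖ ^ 2) := by
      gcongr
    _ = 2 * L ^ 2 * ‖v‖ := by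
      field_simp
end

section
/- Let r ∈ (0,1) and for s ∈ ℝ define the signed power s^⟨r⟩ := |s|^r · sgn(s). Then for all s₁, s₂ ∈ ℝ with (s₁, s₂) ≠ (0, 0): (s₁ − s₂)(s₁^⟨r⟩ − s₂^⟨r⟩) ≥ r |s₁ − s₂|² (max(|s₁|, |s₂|))^{r−1}. -/
/-- If `|b| ≤ a` and `0 < a`, then the signed power increases from `b` to `a` at rate at least
`r * a ^ (r - 1)`. -/
lemma mul_sub_mul_rpow_le_rpow_sub_signed_rpow {r a b : ℝ} (hr0 : 0 < r) (hr1 : r < 1)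
    (ha : 0 < a) (hb : |b| ≤ a) :
    r * (a - b) * a ^ (r - 1) ≤ a ^ r - |b| ^ r * Real.sign b := by
  have har : a ^ r = a * a ^ (r - 1) := by
    rw [Real.rpow_sub_one ha.ne']; field_simp
  have hpos : 0 < a ^ (r - 1) := Real.rpow_pos_of_pos ha _
  have hb' := abs_le.1 hb
  rcases lt_or_ge b 0 with hneg | hnonneg
  · have hbr : |b| * a ^ (r - 1) ≤ |b| ^ r := by
      have hb0 : 0 < |b| := abs_pos.2 hneg.ne
      calc |b| * a ^ (r - 1) ≤ |b| * |b| ^ (r - 1) :=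
            mul_le_mul_of_nonneg_left
              (Real.rpow_le_rpow_of_nonpos hb0 hb (by linarith)) hb0.le
        _ = |b| ^ r := by rw [Real.rpow_sub_one hb0.ne']; field_simp
    rw [abs_of_neg hneg] at hbr ⊢
    rw [Real.sign_of_neg hneg, har]
    have : r * ((a - b) * a ^ (r - 1)) ≤ (a - b) * a ^ (r - 1) :=
      mul_le_of_le_one_left (mul_nonneg (by linarith) hpos.le) hr1.le
    linarith
  · have hsign : |b| ^ r * Real.sign b = b ^ r := by
      rcases hnonneg.eq_or_lt with rfl | hb0
      · simp [Real.zero_rpow hr0.ne']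
      · rw [abs_of_pos hb0, Real.sign_of_pos hb0, mul_one]
    have hbern : (b / a) ^ r ≤ 1 + r * (b / a - 1) := by
      have hba : 0 ≤ b / a := div_nonneg hnonneg ha.le
      simpa using rpow_one_add_le_one_add_mul_self (s := b / a - 1) (by linarith) hr0.le hr1.le
    rw [Real.div_rpow hnonneg ha.le, div_le_iff₀ (Real.rpow_pos_of_pos ha r)] at hbern
    have hexp : (1 + r * (b / a - 1)) * a ^ r = a ^ r - r * (a - b) * a ^ (r - 1) := by
      rw [har]; field_simp; ring
    rw [hsign]
    linarith

/-- The claimed monotonicity bound when the first entry has the larger absolute value. -/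
lemma mul_sq_abs_sub_mul_rpow_le_of_abs_le {r a b : ℝ} (hr0 : 0 < r) (hr1 : r < 1)
    (ha : a ≠ 0) (hb : |b| ≤ |a|) :
    r * |a - b| ^ 2 * |a| ^ (r - 1)
      ≤ (a - b) * (|a| ^ r * Real.sign a - |b| ^ r * Real.sign b) := by
  rw [sq_abs]
  rcases ha.lt_or_gt with hneg | hpos
  · have hb' := abs_le.1 hb
    rw [abs_of_neg hneg] at hb hb' ⊢
    have key := mul_sub_mul_rpow_le_rpow_sub_signed_rpow (b := -b) hr0 hr1
      (neg_pos.2 hneg) (by rwa [abs_neg])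
    rw [abs_neg, Real.sign_neg] at key
    rw [Real.sign_of_neg hneg]
    have := mul_le_mul_of_nonneg_left key (show 0 ≤ b - a by linarith)
    linarith
  · have hb' := abs_le.1 hb
    rw [abs_of_pos hpos] at hb hb' ⊢
    have key := mul_sub_mul_rpow_le_rpow_sub_signed_rpow hr0 hr1 hpos hb
    rw [Real.sign_of_pos hpos]
    have := mul_le_mul_of_nonneg_left key (show 0 ≤ a - b by linarith)
    linarith

/-- For `r ∈ (0,1)` and the signed power `s^⟨r⟩ := |s|^r · sgn(s)`, for all
`s₁, s₂` not both zero: `(s₁ − s₂)(s₁^⟨r⟩ − s₂^⟨r⟩) ≥ r|s₁ − s₂|²(max(|s₁|,|s₂|))^{r−1}`. -/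
theorem stmt3 (r : ℝ) (hr0 : 0 < r) (hr1 : r < 1)
    (s₁ s₂ : ℝ) (h : (s₁, s₂) ≠ (0, 0)) :
    r * |s₁ - s₂| ^ 2 * (max |s₁| |s₂|) ^ (r - 1)
      ≤ (s₁ - s₂) * (|s₁| ^ r * Real.sign s₁ - |s₂| ^ r * Real.sign s₂) := by
  rcases le_total |s₂| |s₁| with hle | hle
  · have h₁ : s₁ ≠ 0 := by
      rintro rfl
      exact h (by simpa using hle)
    rw [max_eq_left hle]
    exact mul_sq_abs_sub_mul_rpow_le_of_abs_le hr0 hr1 h₁ hle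
  · have h₂ : s₂ ≠ 0 := by
      rintro rfl
      exact h (by simpa using hle)
    rw [max_eq_right hle, abs_sub_comm]
    have := mul_sq_abs_sub_mul_rpow_le_of_abs_le hr0 hr1 h₂ hle
    linarith
end

section
/- Let r ≥ 1 and κ ≥ 1 + r. Let (λ_i)_{i≥1} be positive reals, (q_i)_{i≥1} nonzero reals with C := sup_{i≥1} λ_i^{-1} |q_i|^{-2κ/(1+r)} < ∞, and let (a_i)_{i≥1} be reals with ∑_i λ_i^{-1} a_i² < ∞ and ∑_i a_i² < ∞. Then ∑_i q_i^{-2} λ_i^{-1} a_i² ≤ (∑_i λ_i^{-1} a_i²)^{(κ−r−1)/κ} · (∑_i |q_i|^{-2κ/(1+r)} λ_i^{-1} a_i²)^{(1+r)/κ} ≤ C^{(1+r)/κ} (∑_i λ_i^{-1} a_i²)^{(κ−r−1)/κ} (∑_i a_i²)^{(1+r)/κ}. -/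
open ENNReal

/-- Weighted Hölder inequality for infinite sums in `[0, ∞]`. -/
theorem ENNReal.tsum_inner_le_weight_mul_Lp {ι : Type*} {p : ℝ} (hp : 1 ≤ p)
    (w f : ι → ℝ≥0∞) :
    ∑' i, w i * f i ≤ (∑' i, w i) ^ (1 - p⁻¹) * (∑' i, w i * f i ^ p) ^ p⁻¹ := by
  rw [ENNReal.tsum_eq_iSup_sum]
  refine iSup_le fun s => (ENNReal.inner_le_weight_mul_Lp_of_nonneg s hp w f).trans ?_
  have hp0 : 0 ≤ p⁻¹ := by positivity
  have hp1 : 0 ≤ 1 - p⁻¹ := sub_nonneg.2 (inv_le_one_of_one_le₀ hp)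
  gcongr <;> exact ENNReal.sum_le_tsum s

/-- For `r ≥ 1`, `κ ≥ 1 + r`, positive reals `(λᵢ)`, nonzero reals `(qᵢ)` with
`λᵢ⁻¹|qᵢ|^{−2κ/(1+r)} ≤ C` for all `i`, and reals `(aᵢ)` with `∑ λᵢ⁻¹aᵢ² < ∞`, `∑ aᵢ² < ∞`:
`∑ qᵢ⁻²λᵢ⁻¹aᵢ² ≤ (∑ λᵢ⁻¹aᵢ²)^{(κ−r−1)/κ} (∑ |qᵢ|^{−2κ/(1+r)}λᵢ⁻¹aᵢ²)^{(1+r)/κ}`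
`≤ C^{(1+r)/κ} (∑ λᵢ⁻¹aᵢ²)^{(κ−r−1)/κ} (∑ aᵢ²)^{(1+r)/κ}`, sums taken in `[0,∞]`. -/
theorem stmt5 (r κ : ℝ) (hr : 1 ≤ r) (hκ : 1 + r ≤ κ)
    (lam q a : ℕ → ℝ) (hlam : ∀ i, 0 < lam i) (hq : ∀ i, q i ≠ 0)
    (C : ℝ) (hC : ∀ i, (lam i)⁻¹ * |q i| ^ (-(2 * κ / (1 + r))) ≤ C)
    (h1 : Summable fun i => (lam i)⁻¹ * a i ^ 2)
    (h2 : Summable fun i => a i ^ 2) :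
    (∑' i, ENNReal.ofReal ((q i ^ 2)⁻¹ * (lam i)⁻¹ * a i ^ 2))
      ≤ (∑' i, ENNReal.ofReal ((lam i)⁻¹ * a i ^ 2)) ^ ((κ - r - 1) / κ)
        * (∑' i, ENNReal.ofReal (|q i| ^ (-(2 * κ / (1 + r))) * (lam i)⁻¹ * a i ^ 2))
            ^ ((1 + r) / κ) ∧
    (∑' i, ENNReal.ofReal ((lam i)⁻¹ * a i ^ 2)) ^ ((κ - r - 1) / κ)
        * (∑' i, ENNReal.ofReal (|q i| ^ (-(2 * κ / (1 + r))) * (lam i)⁻¹ * a i ^ 2))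
            ^ ((1 + r) / κ)
      ≤ ENNReal.ofReal C ^ ((1 + r) / κ)
        * (∑' i, ENNReal.ofReal ((lam i)⁻¹ * a i ^ 2)) ^ ((κ - r - 1) / κ)
        * (∑' i, ENNReal.ofReal (a i ^ 2)) ^ ((1 + r) / κ) := by
  have hr0 : 0 < 1 + r := by linarith
  have hκ0 : 0 < κ := by linarith
  have hexp : 0 ≤ (1 + r) / κ := by positivity
  have hinv : (κ / (1 + r))⁻¹ = (1 + r) / κ := inv_div _ _
  have hsub : 1 - (κ / (1 + r))⁻¹ = (κ - r - 1) / κ := by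
    rw [hinv]
    field_simp
    ring
  have hw : ∀ i, 0 ≤ (lam i)⁻¹ * a i ^ 2 := fun i =>
    mul_nonneg (inv_nonneg.2 (hlam i).le) (sq_nonneg _)
  have hpow : ∀ i, ((q i ^ 2)⁻¹) ^ (κ / (1 + r)) = |q i| ^ (-(2 * κ / (1 + r))) := fun i => by
    rw [← sq_abs, ← Real.rpow_natCast, ← Real.rpow_neg (abs_nonneg _),
      ← Real.rpow_mul (abs_nonneg _)]
    congr 1
    push_cast
    ring
  constructor
  · have h := ENNReal.tsum_inner_le_weight_mul_Lp ((one_le_div hr0).2 hκ)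
      (fun i => ENNReal.ofReal ((lam i)⁻¹ * a i ^ 2)) (fun i => ENNReal.ofReal (q i ^ 2)⁻¹)
    rw [hsub, hinv] at h
    convert h using 4 with i i
    · rw [← ENNReal.ofReal_mul (hw i)]
      congr 1
      ring
    · funext i
      rw [ENNReal.ofReal_rpow_of_nonneg (by positivity) (by positivity), hpow,
        ← ENNReal.ofReal_mul (hw i)]
      congr 1
      ring
  · have hC0 : 0 ≤ C :=
      (mul_nonneg (inv_nonneg.2 (hlam 0).le) (Real.rpow_nonneg (abs_nonneg _) _)).trans (hC 0)
    rw [mul_comm (ENNReal.ofReal C ^ _), mul_assoc, ← ENNReal.mul_rpow_of_nonneg _ _ hexp,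
      ← ENNReal.tsum_mul_left]
    gcongr with i
    rw [← ENNReal.ofReal_mul hC0]
    apply ENNReal.ofReal_le_ofReal
    rw [mul_comm (|q i| ^ _)]
    exact mul_le_mul_of_nonneg_right (hC i) (sq_nonneg _)
end

section
/- Let p ≥ 2 and κ ≥ p. Let (q_i)_{i≥1} be nonzero reals with M := sup_{i≥1} q_i^{-2} (πi)^{-2p/κ} < ∞, and let (a_i)_{i≥1} be reals with ∑_i a_i² < ∞ and ∑_i (πi)² a_i² < ∞. Then ∑_i q_i^{-2} a_i² ≤ (∑_i a_i²)^{(κ−p)/κ} · (∑_i |q_i|^{-2κ/p} a_i²)^{p/κ} ≤ M (∑_i a_i²)^{(κ−p)/κ} (∑_i (πi)² a_i²)^{p/κ}. -/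
open ENNReal

/-- Hölder's inequality for sums in `[0, ∞]`, with weights `s + t = 1`. -/
theorem ENNReal.tsum_rpow_mul_rpow_le {ι : Type*} (f g : ι → ℝ≥0∞) {s t : ℝ}
    (hs : 0 ≤ s) (ht : 0 ≤ t) (hst : s + t = 1) :
    ∑' i, f i ^ s * g i ^ t ≤ (∑' i, f i) ^ s * (∑' i, g i) ^ t := by
  let _ : MeasurableSpace ι := ⊤
  have h := ENNReal.lintegral_mul_norm_pow_le (μ := MeasureTheory.Measure.count)
    (f := f) (g := g) measurable_from_top.aemeasurable measurable_from_top.aemeasurable hs ht hst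
  simpa only [MeasureTheory.lintegral_count] using h

/-- A term of the interpolated sum as a product of powers of the two end terms. -/
theorem inv_sq_mul_sq_eq_rpow_mul_rpow {p κ x a : ℝ} (hp : 0 < p) (hκ : p ≤ κ) (hx : x ≠ 0) :
    (x ^ 2)⁻¹ * a ^ 2 =
      (a ^ 2) ^ ((κ - p) / κ) * (|x| ^ (-(2 * κ / p)) * a ^ 2) ^ (p / κ) := by
  have hκ0 : 0 < κ := hp.trans_le hκ
  have hx' : 0 < |x| := abs_pos.mpr hx
  have hexp : (κ - p) / κ + p / κ = 1 := by field_simp; ring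
  have ha : (a ^ 2) ^ ((κ - p) / κ) * (a ^ 2) ^ (p / κ) = a ^ 2 := by
    rw [← Real.rpow_add_of_nonneg (sq_nonneg a) (div_nonneg (sub_nonneg.mpr hκ) hκ0.le)
      (by positivity), hexp, Real.rpow_one]
  have hxe : (|x| ^ (-(2 * κ / p))) ^ (p / κ) = (x ^ 2)⁻¹ := by
    rw [← Real.rpow_mul hx'.le, show -(2 * κ / p) * (p / κ) = -(2 : ℕ) by
      push_cast; field_simp, Real.rpow_neg hx'.le, Real.rpow_natCast, sq_abs]
  rw [Real.mul_rpow (by positivity) (sq_nonneg a), hxe, mul_left_comm, ha]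

/-- A bound `x⁻² y^{-2p/κ} ≤ M` raised to the power `κ / p`. -/
theorem abs_rpow_le_of_inv_sq_mul_rpow_le {p κ x y M : ℝ} (hp : 0 < p) (hκ : 0 < κ) (hy : 0 < y)
    (hM : (x ^ 2)⁻¹ * y ^ (-(2 * p / κ)) ≤ M) :
    |x| ^ (-(2 * κ / p)) ≤ M ^ (κ / p) * y ^ 2 := by
  have hle : (x ^ 2)⁻¹ ≤ M * y ^ (2 * p / κ) := by
    rwa [Real.rpow_neg hy.le, ← div_eq_mul_inv, div_le_iff₀ (by positivity)] at hM
  have hM0 : 0 ≤ M := le_trans (by positivity) hM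
  calc |x| ^ (-(2 * κ / p)) = ((x ^ 2)⁻¹) ^ (κ / p) := by
        rw [Real.inv_rpow (sq_nonneg x), ← sq_abs x, ← Real.rpow_natCast,
          ← Real.rpow_mul (abs_nonneg x), ← Real.rpow_neg (abs_nonneg x)]
        congr 1
        push_cast
        ring
    _ ≤ (M * y ^ (2 * p / κ)) ^ (κ / p) :=
        Real.rpow_le_rpow (by positivity) hle (by positivity)
    _ = M ^ (κ / p) * y ^ 2 := by
        rw [Real.mul_rpow hM0 (by positivity), ← Real.rpow_mul hy.le,
          show 2 * p / κ * (κ / p) = (2 : ℕ) by push_cast; field_simp, Real.rpow_natCast]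

/-- For `p ≥ 2`, `κ ≥ p`, nonzero reals `(qᵢ)_{i≥1}` with
`qᵢ⁻²(πi)^{−2p/κ} ≤ M` for all `i`, and reals `(aᵢ)` with `∑ aᵢ² < ∞`, `∑ (πi)²aᵢ² < ∞`:
`∑ qᵢ⁻²aᵢ² ≤ (∑ aᵢ²)^{(κ−p)/κ} (∑ |qᵢ|^{−2κ/p}aᵢ²)^{p/κ}`
`≤ M (∑ aᵢ²)^{(κ−p)/κ} (∑ (πi)²aᵢ²)^{p/κ}`, sums over `i ≥ 1`, taken in `[0,∞]`. -/
theorem stmt6 (p κ : ℝ) (hp : 2 ≤ p) (hκ : p ≤ κ)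
    (q a : ℕ+ → ℝ) (hq : ∀ i, q i ≠ 0)
    (M : ℝ)
    (hM : ∀ i : ℕ+, (q i ^ 2)⁻¹ * (Real.pi * ((i : ℕ) : ℝ)) ^ (-(2 * p / κ)) ≤ M)
    (h1 : Summable fun i : ℕ+ => a i ^ 2)
    (h2 : Summable fun i : ℕ+ => (Real.pi * ((i : ℕ) : ℝ)) ^ 2 * a i ^ 2) :
    (∑' i : ℕ+, ENNReal.ofReal ((q i ^ 2)⁻¹ * a i ^ 2))
      ≤ (∑' i : ℕ+, ENNReal.ofReal (a i ^ 2)) ^ ((κ - p) / κ)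
        * (∑' i : ℕ+, ENNReal.ofReal (|q i| ^ (-(2 * κ / p)) * a i ^ 2)) ^ (p / κ) ∧
    (∑' i : ℕ+, ENNReal.ofReal (a i ^ 2)) ^ ((κ - p) / κ)
        * (∑' i : ℕ+, ENNReal.ofReal (|q i| ^ (-(2 * κ / p)) * a i ^ 2)) ^ (p / κ)
      ≤ ENNReal.ofReal M
        * (∑' i : ℕ+, ENNReal.ofReal (a i ^ 2)) ^ ((κ - p) / κ)
        * (∑' i : ℕ+, ENNReal.ofReal ((Real.pi * ((i : ℕ) : ℝ)) ^ 2 * a i ^ 2)) ^ (p / κ) := by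
  have hp0 : 0 < p := by linarith
  have hκ0 : 0 < κ := hp0.trans_le hκ
  have hs : 0 ≤ (κ - p) / κ := div_nonneg (sub_nonneg.mpr hκ) hκ0.le
  have ht : 0 ≤ p / κ := by positivity
  have hM0 : 0 ≤ M := le_trans (by positivity) (hM 1)
  constructor
  · refine le_of_eq_of_le (tsum_congr fun i => ?_)
      (ENNReal.tsum_rpow_mul_rpow_le _ _ hs ht (by field_simp; ring))
    rw [inv_sq_mul_sq_eq_rpow_mul_rpow hp0 hκ (hq i), ENNReal.ofReal_mul (by positivity),
      ENNReal.ofReal_rpow_of_nonneg (by positivity) hs,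
      ENNReal.ofReal_rpow_of_nonneg (by positivity) ht]
  · have hsum : ∑' i : ℕ+, ENNReal.ofReal (|q i| ^ (-(2 * κ / p)) * a i ^ 2) ≤
        ENNReal.ofReal (M ^ (κ / p)) *
          ∑' i : ℕ+, ENNReal.ofReal ((Real.pi * ((i : ℕ) : ℝ)) ^ 2 * a i ^ 2) := by
      rw [← ENNReal.tsum_mul_left]
      refine ENNReal.tsum_le_tsum fun i => ?_
      rw [← ENNReal.ofReal_mul (by positivity), ← mul_assoc]
      have hi : 0 < Real.pi * ((i : ℕ) : ℝ) := mul_pos Real.pi_pos (by exact_mod_cast i.pos)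
      exact ENNReal.ofReal_le_ofReal (mul_le_mul_of_nonneg_right
        (abs_rpow_le_of_inv_sq_mul_rpow_le hp0 hκ0 hi (hM i)) (sq_nonneg _))
    have hMpow : ENNReal.ofReal (M ^ (κ / p)) ^ (p / κ) = ENNReal.ofReal M := by
      rw [ENNReal.ofReal_rpow_of_nonneg (by positivity) ht, ← Real.rpow_mul hM0,
        show κ / p * (p / κ) = 1 by field_simp, Real.rpow_one]
    rw [mul_comm (ENNReal.ofReal M), mul_assoc]
    refine mul_le_mul_right ((ENNReal.rpow_le_rpow hsum ht).trans_eq ?_) _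
    rw [ENNReal.mul_rpow_of_nonneg _ _ ht, hMpow]
end

section
/- Let r ≥ 1, κ > 2r, θ > 0, K' > 0, and set ε := (κ − 2r)/κ. Then there exists a constant c₂ > 0, depending only on r, κ, θ, such that for every δ > 0, every integer n ≥ 1, every s with 1/n ≤ s ≤ δ, and every q > 0: (1 − (1+ε)s^ε/(4δ^ε)) · (K's − θ q^κ s^{r−κ}) − (ε(1+ε)s^{ε−1}/(4δ^ε)) · (s²/q² − 2/n²) ≤ 2K'(s − s^{1+ε}/(4δ^ε)) + δ^{−ε} n^{−(1+ε)} − c₂ δ^{−εκ/(κ+2)}. -/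
/-- Weighted AM-GM with weights `2/(κ+2)` and `κ/(κ+2)`, for which the powers of `q` and `s`
cancel. -/
lemma rpow_mul_rpow_le_add {r κ ε A B q s δ : ℝ} (hκ : 0 < κ) (hε : ε * κ = κ - 2 * r)
    (hA : 0 < A) (hB : 0 < B) (hq : 0 < q) (hs : 0 < s) (hδ : 0 < δ) :
    A ^ (2 / (κ + 2)) * B ^ (κ / (κ + 2)) * δ ^ (-(ε * κ / (κ + 2))) ≤
      A * q ^ κ * s ^ (r - κ) + B * δ ^ (-ε) * s ^ (1 + ε) * q ^ (-2 : ℝ) := by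
  set X := A * q ^ κ * s ^ (r - κ) with hX
  set Y := B * δ ^ (-ε) * s ^ (1 + ε) * q ^ (-2 : ℝ) with hY
  have hX0 : 0 < X := by positivity
  have hY0 : 0 < Y := by positivity
  have hk : κ + 2 ≠ 0 := by positivity
  have hw₁ : 2 / (κ + 2) ≤ 1 := by rw [div_le_one (by positivity)]; linarith
  have hw₂ : κ / (κ + 2) ≤ 1 := by rw [div_le_one (by positivity)]; linarith
  have hgm := Real.geom_mean_le_arith_mean2_weighted (w₁ := 2 / (κ + 2)) (w₂ := κ / (κ + 2))
    (by positivity) (by positivity) hX0.le hY0.le (by field_simp; ring)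
  have heq : A ^ (2 / (κ + 2)) * B ^ (κ / (κ + 2)) * δ ^ (-(ε * κ / (κ + 2))) =
      X ^ (2 / (κ + 2)) * Y ^ (κ / (κ + 2)) := by
    apply Real.log_injOn_pos (Set.mem_Ioi.2 (by positivity)) (Set.mem_Ioi.2 (by positivity))
    have hlX : Real.log X = Real.log A + κ * Real.log q + (r - κ) * Real.log s := by
      rw [hX, Real.log_mul (by positivity) (by positivity),
        Real.log_mul (by positivity) (by positivity), Real.log_rpow hq, Real.log_rpow hs]
    have hlY : Real.log Y =
        Real.log B + -ε * Real.log δ + (1 + ε) * Real.log s + -2 * Real.log q := by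
      rw [hY, Real.log_mul (by positivity) (by positivity),
        Real.log_mul (by positivity) (by positivity),
        Real.log_mul (by positivity) (by positivity),
        Real.log_rpow hq, Real.log_rpow hs, Real.log_rpow hδ]
    rw [Real.log_mul (by positivity) (by positivity),
      Real.log_mul (by positivity) (by positivity),
      Real.log_mul (by positivity) (by positivity), Real.log_rpow hA, Real.log_rpow hB,
      Real.log_rpow hδ, Real.log_rpow hX0, Real.log_rpow hY0, hlX, hlY]
    field_simp
    linear_combination (-Real.log s) * hε
  rw [heq]
  nlinarith

/-- For `s ≥ 1/n` and `ε < 1`, the singular factor `s ^ (ε - 1)` is at most `n ^ (1 - ε)`. -/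
lemma rpow_sub_one_div_sq_le {ε s : ℝ} {n : ℕ} (hε : ε ≤ 1) (hn : 1 ≤ n)
    (hs : 1 / (n : ℝ) ≤ s) :
    s ^ (ε - 1) / (n : ℝ) ^ 2 ≤ (n : ℝ) ^ (-(1 + ε)) := by
  have hn0 : (0 : ℝ) < n := by exact_mod_cast hn
  have h := Real.rpow_le_rpow_of_nonpos (by positivity) hs (sub_nonpos.2 hε)
  rw [one_div, Real.inv_rpow hn0.le, ← Real.rpow_neg hn0.le] at h
  calc s ^ (ε - 1) / (n : ℝ) ^ 2 ≤ (n : ℝ) ^ (-(ε - 1)) / (n : ℝ) ^ 2 := by gcongr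
    _ = (n : ℝ) ^ (-(1 + ε)) := by
      rw [← Real.rpow_natCast, ← Real.rpow_sub hn0]
      congr 1
      push_cast
      ring

/-- For `r ≥ 1`, `κ > 2r`, `θ > 0` and `ε := (κ−2r)/κ`, there is `c₂ > 0`
(depending only on `r, κ, θ`) such that for all `K' > 0`, `δ > 0`, integers `n ≥ 1`,
`s ∈ [1/n, δ]` and `q > 0`:
`(1 − (1+ε)s^ε/(4δ^ε))(K's − θq^κ s^{r−κ}) − (ε(1+ε)s^{ε−1}/(4δ^ε))(s²/q² − 2/n²)`
`≤ 2K'(s − s^{1+ε}/(4δ^ε)) + δ^{−ε}n^{−(1+ε)} − c₂ δ^{−εκ/(κ+2)}`. -/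
theorem stmt12 (r κ θ : ℝ) (hr : 1 ≤ r) (hκ : 2 * r < κ) (hθ : 0 < θ)
    (ε : ℝ) (hε : ε = (κ - 2 * r) / κ) :
    ∃ c₂ : ℝ, 0 < c₂ ∧ ∀ K' : ℝ, 0 < K' → ∀ δ : ℝ, 0 < δ → ∀ n : ℕ, 1 ≤ n →
      ∀ s : ℝ, 1 / (n : ℝ) ≤ s → s ≤ δ → ∀ q : ℝ, 0 < q →
      (1 - (1 + ε) * s ^ ε / (4 * δ ^ ε)) * (K' * s - θ * q ^ κ * s ^ (r - κ))
          - ε * (1 + ε) * s ^ (ε - 1) / (4 * δ ^ ε) * (s ^ 2 / q ^ 2 - 2 / (n : ℝ) ^ 2)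
        ≤ 2 * K' * (s - s ^ (1 + ε) / (4 * δ ^ ε))
          + δ ^ (-ε) * (n : ℝ) ^ (-(1 + ε))
          - c₂ * δ ^ (-(ε * κ / (κ + 2))) := by
  have hκ0 : 0 < κ := by linarith
  have hεκ : ε * κ = κ - 2 * r := by rw [hε]; field_simp
  have hε0 : 0 < ε := by rw [hε]; exact div_pos (by linarith) hκ0
  have hε1 : ε < 1 := by rw [hε, div_lt_one hκ0]; linarith
  clear hε
  refine ⟨(θ / 2) ^ (2 / (κ + 2)) * (ε * (1 + ε) / 4) ^ (κ / (κ + 2)), by positivity, ?_⟩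
  intro K' hK δ hδ n hn s hns hsδ q hq
  have hn0 : (0 : ℝ) < n := by exact_mod_cast hn
  have hs : 0 < s := lt_of_lt_of_le (by positivity) hns
  have hamgm := rpow_mul_rpow_le_add (A := θ / 2) (B := ε * (1 + ε) / 4) hκ0 hεκ
    (by positivity) (by positivity) hq hs hδ
  have hsing := rpow_sub_one_div_sq_le hε1.le hn hns
  have hδε : δ ^ (-ε) = (δ ^ ε)⁻¹ := Real.rpow_neg hδ.le ε
  have hs1 : s ^ (1 + ε) = s * s ^ ε := by rw [Real.rpow_add hs, Real.rpow_one]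
  have hs2 : s ^ (ε - 1) * s ^ 2 = s ^ (1 + ε) := by
    rw [← Real.rpow_natCast, ← Real.rpow_add hs]; congr 1; push_cast; ring
  have hq2 : q ^ (-2 : ℝ) = (q ^ 2)⁻¹ := by
    rw [Real.rpow_neg hq.le]; norm_cast
  set D := (δ ^ ε)⁻¹ with hD
  have hD0 : 0 < D := by positivity
  set a := s ^ ε * D with ha
  have ha0 : 0 < a := by positivity
  have ha1 : a ≤ 1 := by
    rw [ha, hD, ← div_eq_mul_inv, div_le_one (by positivity)]
    exact Real.rpow_le_rpow hs.le hsδ hε0.le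
  set P := q ^ κ * s ^ (r - κ) with hP
  have hP0 : 0 < P := by positivity
  have hfirst : (1 - (1 + ε) * s ^ ε / (4 * δ ^ ε)) * (K' * s - θ * q ^ κ * s ^ (r - κ)) =
      (1 - (1 + ε) * a / 4) * (K' * s) - (1 - (1 + ε) * a / 4) * (θ * P) := by
    rw [ha, hD, hP]; field_simp
  have hsecond : ε * (1 + ε) * s ^ (ε - 1) / (4 * δ ^ ε) * (s ^ 2 / q ^ 2 - 2 / (n : ℝ) ^ 2) =
      ε * (1 + ε) / 4 * D * s ^ (1 + ε) * (q ^ 2)⁻¹ -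
        ε * (1 + ε) / 2 * (D * (s ^ (ε - 1) / (n : ℝ) ^ 2)) := by
    rw [← hs2, hD]; field_simp; ring
  have hthird : 2 * K' * (s - s ^ (1 + ε) / (4 * δ ^ ε)) = (2 - a / 2) * (K' * s) := by
    rw [hs1, ha, hD]; field_simp; ring
  have hcoef : (1 + ε) * a ≤ 2 := by
    have := mul_le_mul (show 1 + ε ≤ 2 by linarith) ha1 ha0.le zero_le_two
    linarith
  have hdrift : (1 - (1 + ε) * a / 4) * (K' * s) ≤ (2 - a / 2) * (K' * s) := by
    refine mul_le_mul_of_nonneg_right ?_ (by positivity)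
    have : 0 < ε * a := by positivity
    linarith
  have hdamp : θ / 2 * P ≤ (1 - (1 + ε) * a / 4) * (θ * P) := by
    have := mul_le_mul_of_nonneg_right (show 1 / 2 ≤ 1 - (1 + ε) * a / 4 by linarith)
      (show 0 ≤ θ * P by positivity)
    linarith
  have hcorr : ε * (1 + ε) / 2 * (D * (s ^ (ε - 1) / (n : ℝ) ^ 2)) ≤
      D * (n : ℝ) ^ (-(1 + ε)) := by
    have hle : ε * (1 + ε) / 2 ≤ 1 := by
      have := mul_le_mul hε1.le (show 1 + ε ≤ 2 by linarith) (by positivity) zero_le_one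
      linarith
    calc _ ≤ 1 * (D * (n : ℝ) ^ (-(1 + ε))) := by gcongr
      _ = _ := one_mul _
  rw [hδε, hq2, mul_assoc (θ / 2)] at hamgm
  rw [hfirst, hsecond, hthird, hδε]
  linarith
end

section
/- Let r ≥ 1, θ > 0, K' > 0, and define g(s) := ∫₀^s (log(e + 1/z))^{r/(1+r)} dz for s ≥ 0. Then there exists a constant c₁ > 0, depending only on r and θ, such that for every integer n ≥ 1, every s with 1/n ≤ s ≤ 1, and every q > 0: (log(e + 1/s))^{r/(1+r)} · (K's − θ q^{2r} s^{−r}) − (r (log(e + 1/s))^{−1/(1+r)} / ((1+r)(s + e s²))) · (s²/q² − 2/n²) ≤ K' g(s) + 2/n − c₁. -/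
lemma one_le_log_exp_one_add_inv {z : ℝ} (hz : 0 < z) :
    1 ≤ Real.log (Real.exp 1 + 1 / z) := by
  rw [Real.le_log_iff_exp_le (by positivity)]
  have : 0 < 1 / z := by positivity
  linarith

/-- The integrand is dominated on `(0, 1]` by the integrable function `log (e + 1) - log z`. -/
lemma intervalIntegrable_log_exp_one_add_inv_rpow {a s : ℝ} (ha : a ≤ 1)
    (hs : 0 < s) (hs1 : s ≤ 1) :
    IntervalIntegrable (fun z : ℝ => Real.log (Real.exp 1 + 1 / z) ^ a)
      MeasureTheory.volume 0 s := by
  have hdom : IntervalIntegrable (fun z : ℝ => Real.log (Real.exp 1 + 1) - Real.log z)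
      MeasureTheory.volume 0 s :=
    intervalIntegrable_const.sub intervalIntegral.intervalIntegrable_log'
  refine hdom.mono_fun (by fun_prop : Measurable _).aestronglyMeasurable ?_
  rw [Filter.EventuallyLE, MeasureTheory.ae_restrict_iff' measurableSet_uIoc]
  refine Filter.Eventually.of_forall fun z hz => ?_
  rw [Set.uIoc_of_le hs.le] at hz
  have hz0 : 0 < z := hz.1
  have hz1 : z ≤ 1 := hz.2.trans hs1
  have h1 := one_le_log_exp_one_add_inv hz0
  have hle : Real.log (Real.exp 1 + 1 / z) ≤ Real.log (Real.exp 1 + 1) - Real.log z := by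
    rw [← Real.log_div (by positivity) hz0.ne']
    apply Real.log_le_log (by positivity)
    rw [add_div]
    gcongr
    rw [le_div_iff₀ hz0]
    exact mul_le_of_le_one_right (Real.exp_pos 1).le hz1
  rw [Real.norm_of_nonneg (by positivity), Real.norm_of_nonneg (by linarith)]
  calc Real.log (Real.exp 1 + 1 / z) ^ a ≤ Real.log (Real.exp 1 + 1 / z) ^ (1 : ℝ) :=
        Real.rpow_le_rpow_of_exponent_le h1 ha
    _ ≤ _ := by rwa [Real.rpow_one]

lemma mul_log_exp_one_add_inv_rpow_le_integral {a s : ℝ} (ha0 : 0 ≤ a) (ha : a ≤ 1)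
    (hs : 0 < s) (hs1 : s ≤ 1) :
    s * Real.log (Real.exp 1 + 1 / s) ^ a
      ≤ ∫ z in (0 : ℝ)..s, Real.log (Real.exp 1 + 1 / z) ^ a := by
  have hmono := intervalIntegral.integral_mono_on_of_le_Ioo
    (f := fun _ : ℝ => Real.log (Real.exp 1 + 1 / s) ^ a) hs.le intervalIntegrable_const
    (intervalIntegrable_log_exp_one_add_inv_rpow ha hs hs1) fun z hz => by
      have hz0 : 0 < z := hz.1
      have h1 := one_le_log_exp_one_add_inv hs
      have hzs : z ≤ s := hz.2.le
      gcongr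
  simpa using hmono

lemma min_le_mul_rpow_add_div {θ k r v : ℝ} (hθ : 0 ≤ θ) (hk : 0 ≤ k) (hr : 0 ≤ r)
    (hv : 0 < v) : min θ k ≤ θ * v ^ r + k / v := by
  rcases le_total 1 v with h | h
  · have h1 : θ ≤ θ * v ^ r := le_mul_of_one_le_right hθ (Real.one_le_rpow h hr)
    have h2 : 0 ≤ k / v := by positivity
    linarith [min_le_left θ k]
  · have h1 : k ≤ k / v := le_div_self hk hv h
    have h2 : 0 ≤ θ * v ^ r := by positivity
    linarith [min_le_right θ k]

/-- After the substitution `v = L ^ (1 / (1 + r)) * q ^ 2 / s`, the two dissipative terms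
balance as `θ * v ^ r + k / v`. -/
lemma min_le_dissipation {r θ L s q : ℝ} (hr : 0 < r) (hθ : 0 ≤ θ) (hL : 0 < L)
    (hs : 0 < s) (hs1 : s ≤ 1) (hq : 0 < q) :
    min θ (r / ((1 + r) * (1 + Real.exp 1))) ≤
      L ^ (r / (1 + r)) * (θ * q ^ (2 * r) * s ^ (-r))
        + r * L ^ (-(1 / (1 + r))) / ((1 + r) * (s + Real.exp 1 * s ^ 2)) * (s ^ 2 / q ^ 2) := by
  have hM : 0 < L ^ (1 / (1 + r)) := by positivity
  have hfirst : L ^ (r / (1 + r)) * (θ * q ^ (2 * r) * s ^ (-r))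
      = θ * (L ^ (1 / (1 + r)) * q ^ 2 / s) ^ r := by
    rw [Real.div_rpow (by positivity) hs.le, Real.mul_rpow hM.le (by positivity),
      ← Real.rpow_mul hL.le, Real.rpow_neg hs.le, Real.rpow_mul hq.le, Real.rpow_two,
      one_div_mul_eq_div]
    ring
  have hsecond : r / ((1 + r) * (1 + Real.exp 1)) / (L ^ (1 / (1 + r)) * q ^ 2 / s)
      ≤ r * L ^ (-(1 / (1 + r))) / ((1 + r) * (s + Real.exp 1 * s ^ 2)) * (s ^ 2 / q ^ 2) := by
    have hrw : r * L ^ (-(1 / (1 + r))) / ((1 + r) * (s + Real.exp 1 * s ^ 2)) * (s ^ 2 / q ^ 2)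
        = r / ((1 + r) * (1 + Real.exp 1 * s)) / (L ^ (1 / (1 + r)) * q ^ 2 / s) := by
      rw [Real.rpow_neg hL.le, show s + Real.exp 1 * s ^ 2 = s * (1 + Real.exp 1 * s) by ring]
      have hne : 1 + Real.exp 1 * s ≠ 0 := by positivity
      generalize L ^ (1 / (1 + r)) = M at *
      field_simp
    rw [hrw]
    gcongr
    exact mul_le_of_le_one_right (Real.exp_pos 1).le hs1
  rw [hfirst]
  exact (min_le_mul_rpow_add_div hθ (by positivity) hr.le (by positivity)).trans
    (add_le_add_right hsecond _)

lemma mul_two_div_sq_le {r L s m : ℝ} (hr : 0 < r) (hL : 1 ≤ L) (hm : 0 < m)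
    (hs : 1 / m ≤ s) :
    r * L ^ (-(1 / (1 + r))) / ((1 + r) * (s + Real.exp 1 * s ^ 2)) * (2 / m ^ 2) ≤ 2 / m := by
  have hs0 : 0 < s := lt_of_lt_of_le (by positivity) hs
  have hM : L ^ (-(1 / (1 + r))) ≤ 1 :=
    Real.rpow_le_one_of_one_le_of_nonpos hL (neg_nonpos.2 (by positivity))
  have hcoef : r * L ^ (-(1 / (1 + r))) / ((1 + r) * (s + Real.exp 1 * s ^ 2)) ≤ m := by
    have hms : 1 ≤ s * m := (div_le_iff₀ hm).1 hs
    rw [div_le_iff₀ (by positivity)]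
    have h1 : r * L ^ (-(1 / (1 + r))) ≤ r := mul_le_of_le_one_right hr.le hM
    have h2 : (1 + r) * 1 ≤ (1 + r) * (s * m) := by gcongr
    have h3 : 0 ≤ m * ((1 + r) * (Real.exp 1 * s ^ 2)) := by positivity
    nlinarith
  calc _ ≤ m * (2 / m ^ 2) := by gcongr
    _ = 2 / m := by field_simp


/-- For `r ≥ 1`, `θ > 0` and `g(s) := ∫₀ˢ (log(e + 1/z))^{r/(1+r)} dz`, there is
`c₁ > 0` (depending only on `r, θ`) such that for all `K' > 0`, integers `n ≥ 1`,
`s ∈ [1/n, 1]` and `q > 0`: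
`(log(e+1/s))^{r/(1+r)}(K's − θq^{2r}s^{−r})`
`− (r(log(e+1/s))^{−1/(1+r)}/((1+r)(s+es²)))(s²/q² − 2/n²) ≤ K'g(s) + 2/n − c₁`. -/
theorem stmt13 (r θ : ℝ) (hr : 1 ≤ r) (hθ : 0 < θ)
    (g : ℝ → ℝ)
    (hg : ∀ s : ℝ, g s = ∫ z in (0 : ℝ)..s, Real.log (Real.exp 1 + 1 / z) ^ (r / (1 + r))) :
    ∃ c₁ : ℝ, 0 < c₁ ∧ ∀ K' : ℝ, 0 < K' → ∀ n : ℕ, 1 ≤ n →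
      ∀ s : ℝ, 1 / (n : ℝ) ≤ s → s ≤ 1 → ∀ q : ℝ, 0 < q →
      Real.log (Real.exp 1 + 1 / s) ^ (r / (1 + r)) * (K' * s - θ * q ^ (2 * r) * s ^ (-r))
          - r * Real.log (Real.exp 1 + 1 / s) ^ (-(1 / (1 + r)))
              / ((1 + r) * (s + Real.exp 1 * s ^ 2)) * (s ^ 2 / q ^ 2 - 2 / (n : ℝ) ^ 2)
        ≤ K' * g s + 2 / (n : ℝ) - c₁ := by
  have hr0 : 0 < r := by linarith
  refine ⟨min θ (r / ((1 + r) * (1 + Real.exp 1))), lt_min hθ (by positivity), ?_⟩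
  intro K' hK n hn s hs hs1 q hq
  have hn0 : (0 : ℝ) < n := by exact_mod_cast hn
  have hs0 : 0 < s := lt_of_lt_of_le (by positivity) hs
  have hL := one_le_log_exp_one_add_inv hs0
  have hdrift := mul_le_mul_of_nonneg_left (mul_log_exp_one_add_inv_rpow_le_integral
    (a := r / (1 + r)) (by positivity) (by rw [div_le_one (by positivity)]; linarith)
    hs0 hs1) hK.le
  rw [← hg] at hdrift
  have hdiss := min_le_dissipation hr0 hθ.le (by linarith) hs0 hs1 hq
    (L := Real.log (Real.exp 1 + 1 / s))
  have herr := mul_two_div_sq_le hr0 hL hn0 hs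
  rw [mul_sub, mul_sub]
  linarith
end

section
/- Let r ≥ 1, r − 1 < κ < 2r, θ > 0, K' > 0, and set ε := 2(κ + 1 − r)/(κ + 2), so ε ∈ (0,1). Then there exists a constant c₁ > 0, depending only on r, κ, θ, such that for every integer n ≥ 1, every s with 1/n ≤ s ≤ 1, and every q > 0: ε s^{ε−1} (K's − θ q^κ s^{r−κ}) − ε(1−ε) s^{ε−2} (s²/q² − 2/n²) ≤ ε K' s^ε + 2ε(1−ε) n^{−ε} − c₁. -/
/-- For `t > 0` and `κ ≥ 0`, one of `t ^ κ` and `t ^ (-2)` is at least `1`. -/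
lemma min_le_mul_rpow_add_mul_rpow_neg_two {A B κ t : ℝ} (hA : 0 ≤ A) (hB : 0 ≤ B) (hκ : 0 ≤ κ)
    (ht : 0 < t) : min A B ≤ A * t ^ κ + B * t ^ (-2 : ℝ) := by
  have hAt : 0 ≤ A * t ^ κ := by positivity
  have hBt : 0 ≤ B * t ^ (-2 : ℝ) := by positivity
  rcases le_total 1 t with h | h
  · have := mul_le_mul_of_nonneg_left (Real.one_le_rpow h hκ) hA
    linarith [min_le_left A B]
  · have := mul_le_mul_of_nonneg_left
      (Real.one_le_rpow_of_pos_of_le_one_of_nonpos ht h (by norm_num : (-2 : ℝ) ≤ 0)) hB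
    linarith [min_le_right A B]

/-- If `x⁻¹ ≤ s` and `a ≤ 2`, then `s ^ (a - 2) / x ^ 2 ≤ x ^ (-a)`. -/
lemma rpow_sub_two_div_sq_le {s x a : ℝ} (hx : 0 < x) (hs : 1 / x ≤ s) (ha : a ≤ 2) :
    s ^ (a - 2) / x ^ 2 ≤ x ^ (-a) := by
  have h := Real.rpow_le_rpow_of_nonpos (one_div_pos.2 hx) hs (sub_nonpos.2 ha)
  rw [one_div, Real.inv_rpow hx.le, ← Real.rpow_neg hx.le] at h
  rw [div_le_iff₀ (by positivity), ← Real.rpow_natCast x 2, ← Real.rpow_add hx]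
  rwa [show -a + ((2 : ℕ) : ℝ) = -(a - 2) by push_cast; ring]

/-- For `r ≥ 1`, `r − 1 < κ < 2r`, `θ > 0` and `ε := 2(κ+1−r)/(κ+2) ∈ (0,1)`,
there is `c₁ > 0` (depending only on `r, κ, θ`) such that for all `K' > 0`, integers `n ≥ 1`,
`s ∈ [1/n, 1]` and `q > 0`:
`εs^{ε−1}(K's − θq^κ s^{r−κ}) − ε(1−ε)s^{ε−2}(s²/q² − 2/n²) ≤ εK's^ε + 2ε(1−ε)n^{−ε} − c₁`. -/
theorem stmt14 (r κ θ : ℝ) (hr : 1 ≤ r) (hκ1 : r - 1 < κ) (hκ2 : κ < 2 * r) (hθ : 0 < θ)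
    (ε : ℝ) (hε : ε = 2 * (κ + 1 - r) / (κ + 2)) :
    ∃ c₁ : ℝ, 0 < c₁ ∧ ∀ K' : ℝ, 0 < K' → ∀ n : ℕ, 1 ≤ n →
      ∀ s : ℝ, 1 / (n : ℝ) ≤ s → s ≤ 1 → ∀ q : ℝ, 0 < q →
      ε * s ^ (ε - 1) * (K' * s - θ * q ^ κ * s ^ (r - κ))
          - ε * (1 - ε) * s ^ (ε - 2) * (s ^ 2 / q ^ 2 - 2 / (n : ℝ) ^ 2)
        ≤ ε * K' * s ^ ε + 2 * ε * (1 - ε) * (n : ℝ) ^ (-ε) - c₁ := by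
  have hκ : 0 < κ + 2 := by linarith
  have hε0 : 0 < ε := by
    rw [hε]
    exact div_pos (by linarith) hκ
  have hε1 : 0 < 1 - ε := by
    have : ε < 1 := by
      rw [hε, div_lt_one hκ]
      linarith
    linarith
  have hεκ : ε * (κ + 2) = 2 * (κ + 1 - r) := by
    rw [hε]
    field_simp
  refine ⟨min (ε * θ) (ε * (1 - ε)), by positivity, fun K' _ n hn s hns _ q hq => ?_⟩
  have hn0 : (0 : ℝ) < n := by exact_mod_cast hn
  have hs : 0 < s := (one_div_pos.2 hn0).trans_le hns
  have hrem := mul_le_mul_of_nonneg_left (rpow_sub_two_div_sq_le hn0 hns (by linarith : ε ≤ 2))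
    (by positivity : 0 ≤ 2 * ε * (1 - ε))
  -- In the variable `t = q * s ^ (-ε / 2)` the two dissipative terms do not depend on `s`.
  have hmin := min_le_mul_rpow_add_mul_rpow_neg_two (by positivity : 0 ≤ ε * θ)
    (by positivity : 0 ≤ ε * (1 - ε)) (by linarith : 0 ≤ κ)
    (by positivity : 0 < q * s ^ (-ε / 2))
  have hdrift : (q * s ^ (-ε / 2)) ^ κ = q ^ κ * (s ^ (ε - 1) * s ^ (r - κ)) := by
    rw [Real.mul_rpow hq.le (by positivity), ← Real.rpow_mul hs.le, ← Real.rpow_add hs]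
    congr 2
    linarith
  have hdiff : (q * s ^ (-ε / 2)) ^ (-2 : ℝ) = s ^ (ε - 2) * (s ^ 2 / q ^ 2) := by
    rw [Real.mul_rpow hq.le (by positivity), ← Real.rpow_mul hs.le, Real.rpow_neg hq.le,
      Real.rpow_sub hs, Real.rpow_two, Real.rpow_two]
    rw [show -ε / 2 * -2 = ε by ring]
    field_simp
  have hgrowth : s ^ ε = s ^ (ε - 1) * s := by
    rw [← Real.rpow_add_one hs.ne', sub_add_cancel]
  rw [hdrift, hdiff] at hmin
  rw [hgrowth]
  linear_combination hmin + hrem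
end

section
/- Let r > 1, r − 1 < κ < 2(r − 1), θ > 0, and set ε := 2(κ + 1 − r)/κ, so ε ∈ (0,1). Then there exists a constant c₂ > 0, depending only on r, κ, θ, such that for every λ > 0 and all s > 0, q > 0: λ ε θ s^{r+ε−1} (q/s)^κ + λ² ε² s^{2(ε−1)} · (s²/q²) ≥ c₂ λ^{2(κ+1)/(κ+2)} s^ε. -/
/-- Weighted AM-GM with the weights dropped from the right-hand side. -/
theorem rpow_mul_rpow_le_add_s15 {v w a b : ℝ} (hv : 0 ≤ v) (hw : 0 ≤ w) (hvw : v + w = 1)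
    (ha : 0 ≤ a) (hb : 0 ≤ b) : a ^ v * b ^ w ≤ a + b := by
  refine (Real.geom_mean_le_arith_mean2_weighted hv hw ha hb hvw).trans ?_
  have hav : v * a ≤ a := mul_le_of_le_one_left ha (by linarith)
  have hbw : w * b ≤ b := mul_le_of_le_one_left hb (by linarith)
  linarith

/-- For `r > 1`, `r − 1 < κ < 2(r−1)`, `θ > 0` and `ε := 2(κ+1−r)/κ ∈ (0,1)`,
there is `c₂ > 0` (depending only on `r, κ, θ`) such that for all `λ > 0` and `s, q > 0`:
`λεθ s^{r+ε−1}(q/s)^κ + λ²ε²s^{2(ε−1)}(s²/q²) ≥ c₂ λ^{2(κ+1)/(κ+2)} s^ε`. -/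
theorem stmt15 (r κ θ : ℝ) (hr : 1 < r) (hκ1 : r - 1 < κ) (hκ2 : κ < 2 * (r - 1)) (hθ : 0 < θ)
    (ε : ℝ) (hε : ε = 2 * (κ + 1 - r) / κ) :
    ∃ c₂ : ℝ, 0 < c₂ ∧ ∀ lam : ℝ, 0 < lam → ∀ s : ℝ, 0 < s → ∀ q : ℝ, 0 < q →
      c₂ * lam ^ (2 * (κ + 1) / (κ + 2)) * s ^ ε
        ≤ lam * ε * θ * s ^ (r + ε - 1) * (q / s) ^ κ
          + lam ^ 2 * ε ^ 2 * s ^ (2 * (ε - 1)) * (s ^ 2 / q ^ 2) := by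
  have hκ : 0 < κ := by linarith
  have hε0 : 0 < ε := by
    rw [hε]
    exact div_pos (by linarith) hκ
  have hεκ : ε * κ = 2 * (κ + 1 - r) := by
    rw [hε]
    field_simp
  have hsum : 2 / (κ + 2) + κ / (κ + 2) = 1 := by
    field_simp
    ring
  refine ⟨(ε * θ) ^ (2 / (κ + 2)) * (ε ^ 2) ^ (κ / (κ + 2)), by positivity, ?_⟩
  intro lam hlam s hs q hq
  refine le_trans (le_of_eq ?_)
    (rpow_mul_rpow_le_add_s15 (v := 2 / (κ + 2)) (w := κ / (κ + 2)) (by positivity) (by positivity)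
      hsum (by positivity) (by positivity))
  obtain ⟨a, rfl⟩ : ∃ a, Real.exp a = lam := ⟨_, Real.exp_log hlam⟩
  obtain ⟨b, rfl⟩ : ∃ b, Real.exp b = s := ⟨_, Real.exp_log hs⟩
  obtain ⟨d, rfl⟩ : ∃ d, Real.exp d = q := ⟨_, Real.exp_log hq⟩
  obtain ⟨e, rfl⟩ : ∃ e, Real.exp e = ε := ⟨_, Real.exp_log hε0⟩
  obtain ⟨t, rfl⟩ : ∃ t, Real.exp t = θ := ⟨_, Real.exp_log hθ⟩
  simp only [← Real.exp_mul, ← Real.exp_add, ← Real.exp_sub, ← Real.exp_nat_mul]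
  congr 1
  push_cast
  field_simp
  linear_combination (-b) * hεκ
end
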